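/- arXiv:1707.07116 — 2 statements merged into one kernel-verified Lean document; each statement's English description precedes it below -/
import Mathlib

section
/- Let Z, M ∈ ℕ with M ≥ 1, let l, u : Fin Z → ℝ with l z ≤ u z for all z, and let W_z be the associated support matrices. Let H be a symmetric real (Z+1)×(Z+1) matrix, β ∈ ℝ, y_m ∈ ℝ^Z, y_m^0 ∈ ℝ and γ_m > 0 for m = 1,…,M, and nonnegative vectors τ_0, τ_1, …, τ_M ∈ ℝ^Z. Suppose: (i) H + Σ_z (τ_0)_z·W_z is positive semidefinite; (ii) for each m = 1,…,M, H + Σ_z (τ_m)_z·W_z − N_m is positive semidefinite, where N_m is the symmetric matrix with zero top-left Z×Z block, last column/row (γ_m/2)·y_m, and bottom-right entry γ_m·y_m^0 − β. Then for every ξ ∈ Ξ, max( max_{m=1,…,M} γ_m·(y_mᵀξ + y_m^0) − β, 0 ) ≤ ξ̂ᵀ H ξ̂, where ξ̂ = (ξ,1) is the homogenization of ξ. -/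
open Matrix

/-- The support matrix `W_z` associated with box bounds `l, u`. -/
noncomputable def suppW {Z : ℕ} (l u : Fin Z → ℝ) (z : Fin Z) :
    Matrix (Fin (Z + 1)) (Fin (Z + 1)) ℝ :=
  Matrix.of fun i j =>
    if i = Fin.castSucc z ∧ j = Fin.castSucc z then 1
    else if (i = Fin.castSucc z ∧ j = Fin.last Z) ∨ (i = Fin.last Z ∧ j = Fin.castSucc z) then
      -(l z + u z) / 2
    else if i = Fin.last Z ∧ j = Fin.last Z then l z * u z
    else 0

/-- The homogenization `ξ̂ = (ξ, 1)` of `ξ`. -/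
noncomputable def hom {Z : ℕ} (ξ : Fin Z → ℝ) : Fin (Z + 1) → ℝ := Fin.snoc ξ 1

/-- The quadratic form `ξ̂ᵀ A ξ̂` on homogenized vectors. -/
noncomputable def quadForm {Z : ℕ} (A : Matrix (Fin (Z + 1)) (Fin (Z + 1)) ℝ)
    (ξ : Fin Z → ℝ) : ℝ :=
  hom ξ ⬝ᵥ A.mulVec (hom ξ)

/-- The symmetric matrix with zero top-left `Z×Z` block, last column/row equal to `v`
(on its first `Z` entries) and bottom-right entry `c`. -/
noncomputable def borderMat {Z : ℕ} (v : Fin Z → ℝ) (c : ℝ) :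
    Matrix (Fin (Z + 1)) (Fin (Z + 1)) ℝ :=
  Matrix.of fun i j =>
    if hi : i = Fin.last Z then (if _hj : j = Fin.last Z then c else v (j.castPred _hj))
    else if _hj : j = Fin.last Z then v (i.castPred hi)
    else 0

/-- The maximum of `f m` over all `m : Fin M`, for `M ≥ 1`. -/
noncomputable def maxOver {M : ℕ} (hM : 1 ≤ M) (f : Fin M → ℝ) : ℝ :=
  Finset.univ.sup' ⟨⟨0, hM⟩, Finset.mem_univ _⟩ f

lemma quadForm_add {Z : ℕ} (A B : Matrix (Fin (Z + 1)) (Fin (Z + 1)) ℝ) (ξ : Fin Z → ℝ) :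
    quadForm (A + B) ξ = quadForm A ξ + quadForm B ξ := by
  simp [quadForm, Matrix.add_mulVec]

lemma quadForm_sub {Z : ℕ} (A B : Matrix (Fin (Z + 1)) (Fin (Z + 1)) ℝ) (ξ : Fin Z → ℝ) :
    quadForm (A - B) ξ = quadForm A ξ - quadForm B ξ := by
  simp [quadForm, Matrix.sub_mulVec]

lemma quadForm_sum_smul {Z : ℕ} {ι : Type*} (s : Finset ι) (t : ι → ℝ)
    (A : ι → Matrix (Fin (Z + 1)) (Fin (Z + 1)) ℝ) (ξ : Fin Z → ℝ) :
    quadForm (∑ i ∈ s, t i • A i) ξ = ∑ i ∈ s, t i * quadForm (A i) ξ := by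
  simp [quadForm, Matrix.sum_mulVec, Matrix.smul_mulVec, dotProduct_sum]

lemma quadForm_nonneg {Z : ℕ} {A : Matrix (Fin (Z + 1)) (Fin (Z + 1)) ℝ} (hA : A.PosSemidef)
    (ξ : Fin Z → ℝ) : 0 ≤ quadForm A ξ := by
  simpa [quadForm] using hA.dotProduct_mulVec_nonneg (hom ξ)

lemma quadForm_suppW {Z : ℕ} (l u : Fin Z → ℝ) (z : Fin Z) (ξ : Fin Z → ℝ) :
    quadForm (suppW l u z) ξ = (ξ z - l z) * (ξ z - u z) := by
  simp only [quadForm, hom, suppW, dotProduct, mulVec, Fin.sum_univ_castSucc, Matrix.of_apply,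
    Fin.snoc_castSucc, Fin.snoc_last, Fin.castSucc_inj, Fin.castSucc_ne_last,
    (Fin.castSucc_ne_last _).symm, and_false, or_false, false_or, and_true,
    if_false, if_true, mul_one, one_mul, ite_and]
  simp [Finset.sum_add_distrib, mul_add]
  ring

lemma quadForm_borderMat {Z : ℕ} (v : Fin Z → ℝ) (c : ℝ) (ξ : Fin Z → ℝ) :
    quadForm (borderMat v c) ξ = 2 * (v ⬝ᵥ ξ) + c := by
  have h : ∑ z, ξ z * v z = ∑ z, v z * ξ z := Finset.sum_congr rfl fun z _ => mul_comm _ _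
  simp [quadForm, hom, borderMat, dotProduct, mulVec, Fin.sum_univ_castSucc,
    Fin.castSucc_ne_last, h]
  ring

lemma sum_mul_quadForm_suppW_nonpos {Z : ℕ} {l u t ξ : Fin Z → ℝ} (ht : ∀ z, 0 ≤ t z)
    (hξ : ∀ z, l z ≤ ξ z ∧ ξ z ≤ u z) : ∑ z, t z * quadForm (suppW l u z) ξ ≤ 0 := by
  refine Finset.sum_nonpos fun z _ => mul_nonpos_of_nonneg_of_nonpos (ht z) ?_
  rw [quadForm_suppW]
  exact mul_nonpos_of_nonneg_of_nonpos (sub_nonneg.2 (hξ z).1) (sub_nonpos.2 (hξ z).2)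

theorem stmt9 (Z M : ℕ) (hM : 1 ≤ M) (l u : Fin Z → ℝ) (hlu : ∀ z, l z ≤ u z)
    (H : Matrix (Fin (Z + 1)) (Fin (Z + 1)) ℝ) (hH : H.IsSymm) (β : ℝ)
    (y : Fin M → Fin Z → ℝ) (y0 : Fin M → ℝ) (γ : Fin M → ℝ) (hγ : ∀ m, 0 < γ m)
    (τ0 : Fin Z → ℝ) (hτ0 : ∀ z, 0 ≤ τ0 z)
    (τ : Fin M → Fin Z → ℝ) (hτ : ∀ m z, 0 ≤ τ m z)
    (hpsd0 : (H + ∑ z : Fin Z, τ0 z • suppW l u z).PosSemidef)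
    (hpsd : ∀ m : Fin M, (H + ∑ z : Fin Z, τ m z • suppW l u z -
      borderMat ((γ m / 2) • y m) (γ m * y0 m - β)).PosSemidef) :
    ∀ ξ : Fin Z → ℝ, (∀ z, l z ≤ ξ z ∧ ξ z ≤ u z) →
      max ((maxOver hM fun m => γ m * (y m ⬝ᵥ ξ + y0 m)) - β) 0 ≤ quadForm H ξ := by
  intro ξ hξ
  refine max_le ?_ ?_
  · rw [sub_le_iff_le_add]
    refine Finset.sup'_le _ _ fun m _ => ?_
    have h := quadForm_nonneg (hpsd m) ξ
    rw [quadForm_sub, quadForm_add, quadForm_sum_smul, quadForm_borderMat, smul_dotProduct,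
      smul_eq_mul] at h
    linarith [sum_mul_quadForm_suppW_nonpos (hτ m) hξ]
  · have h := quadForm_nonneg hpsd0 ξ
    rw [quadForm_add, quadForm_sum_smul] at h
    linarith [sum_mul_quadForm_suppW_nonpos hτ0 hξ]
end

section
/- (Main conservativeness theorem for the LMI reformulation.) Let Z, M ∈ ℕ with M ≥ 1, ε ∈ (0,1), l, u : Fin Z → ℝ with l z ≤ u z, W_z the associated support matrices, μ ∈ ℝ^Z, Σ ∈ ℝ^{Z×Z} symmetric, and B the moment matrix of (μ, Σ). Let y_m ∈ ℝ^Z, y_m^0 ∈ ℝ and γ_m > 0 for m = 1,…,M. Suppose there exist a symmetric real (Z+1)×(Z+1) matrix H, β ∈ ℝ, and nonnegative vectors τ_0, τ_1, …, τ_M ∈ ℝ^Z such that: (i) β + ε⁻¹·Tr(B·H) ≤ 0; (ii) H + Σ_z (τ_0)_z·W_z is positive semidefinite; (iii) for each m = 1,…,M, H + Σ_z (τ_m)_z·W_z − N_m is positive semidefinite, where N_m is the symmetric matrix with zero top-left Z×Z block, last column/row (γ_m/2)·y_m and bottom-right entry γ_m·y_m^0 − β. Then for every probability measure F on ℝ^Z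 with F(Ξ) = 1, each coordinate and each product of two coordinates F-integrable, ∫ ξ dF = μ and ∫ ξξᵀ dF = Σ + μμᵀ, it holds that F({ξ ∈ ℝ^Z : y_mᵀξ + y_m^0 ≤ 0 for all m = 1,…,M}) ≥ 1 − ε. That is, feasibility of the LMI system (25)–(28) guarantees the distributionally robust joint chance constraint at confidence level 1 − ε over all distributions with the given support and first and second moments. -/
open MeasureTheory Matrix

/-- The moment matrix `B = [[Σ + μμᵀ, μ], [μᵀ, 1]]` of `(μ, Σ)`. -/
noncomputable def momentMatrix {Z : ℕ} (μ : Fin Z → ℝ) (S : Matrix (Fin Z) (Fin Z) ℝ) :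
    Matrix (Fin (Z + 1)) (Fin (Z + 1)) ℝ :=
  Matrix.of fun i j =>
    if hi : i = Fin.last Z then
      (if _hj : j = Fin.last Z then 1 else μ (j.castPred _hj))
    else if _hj : j = Fin.last Z then μ (i.castPred hi)
    else S (i.castPred hi) (j.castPred _hj) + μ (i.castPred hi) * μ (j.castPred _hj)

/-- Homogenization `(ξ, 1)` of a vector `ξ`. -/
def homogenize {Z : ℕ} (ξ : Fin Z → ℝ) : Fin (Z + 1) → ℝ :=
  Fin.snoc ξ 1

@[simp]
lemma homogenize_castSucc {Z : ℕ} (ξ : Fin Z → ℝ) (z : Fin Z) :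
    homogenize ξ z.castSucc = ξ z := by
  simp [homogenize]

@[simp]
lemma homogenize_last {Z : ℕ} (ξ : Fin Z → ℝ) : homogenize ξ (Fin.last Z) = 1 := by
  simp [homogenize]

lemma homogenize_dotProduct_suppW_mulVec {Z : ℕ} (l u ξ : Fin Z → ℝ) (z : Fin Z) :
    homogenize ξ ⬝ᵥ suppW l u z *ᵥ homogenize ξ = (ξ z - l z) * (ξ z - u z) := by
  have h (i : Fin Z) : Fin.last Z ≠ i.castSucc := (Fin.castSucc_lt_last i).ne'
  simp only [dotProduct, mulVec, suppW, of_apply, Fin.sum_univ_castSucc,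
    homogenize_castSucc, homogenize_last, Fin.castSucc_inj, h, (h _).symm, and_false,
    or_false, false_or, and_true, if_false, if_true, ite_and, ite_mul, mul_ite,
    zero_mul, mul_zero, mul_one, one_mul, mul_add, Finset.sum_add_distrib,
    Finset.sum_ite_eq', Finset.mem_univ]
  simp
  ring

lemma homogenize_dotProduct_borderMat_mulVec {Z : ℕ} (v ξ : Fin Z → ℝ) (c : ℝ) :
    homogenize ξ ⬝ᵥ borderMat v c *ᵥ homogenize ξ = 2 * (v ⬝ᵥ ξ) + c := by
  simp only [dotProduct, mulVec, borderMat, of_apply, Fin.sum_univ_castSucc]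
  simp [mul_comm]
  ring

lemma homogenize_dotProduct_sum_suppW_mulVec_nonpos {Z : ℕ} {l u τ ξ : Fin Z → ℝ}
    (hτ : ∀ z, 0 ≤ τ z) (hξ : ∀ z, l z ≤ ξ z ∧ ξ z ≤ u z) :
    homogenize ξ ⬝ᵥ (∑ z, τ z • suppW l u z) *ᵥ homogenize ξ ≤ 0 := by
  rw [sum_mulVec, dotProduct_sum]
  refine Finset.sum_nonpos fun z _ => ?_
  rw [smul_mulVec, dotProduct_smul, homogenize_dotProduct_suppW_mulVec, smul_eq_mul]
  exact mul_nonpos_of_nonneg_of_nonpos (hτ z) (mul_nonpos_of_nonneg_of_nonpos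
    (sub_nonneg.2 (hξ z).1) (sub_nonpos.2 (hξ z).2))

lemma integrable_homogenize_mul {Z : ℕ} {F : Measure (Fin Z → ℝ)} [IsFiniteMeasure F]
    (h1 : ∀ z : Fin Z, Integrable (fun ξ : Fin Z → ℝ => ξ z) F)
    (h2 : ∀ z z' : Fin Z, Integrable (fun ξ : Fin Z → ℝ => ξ z * ξ z') F)
    (i j : Fin (Z + 1)) :
    Integrable (fun ξ => homogenize ξ i * homogenize ξ j) F := by
  refine Fin.lastCases ?_ (fun i => ?_) i <;> refine Fin.lastCases ?_ (fun j => ?_) j <;>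
    simp [h1, h2]

lemma integral_homogenize_mul {Z : ℕ} {F : Measure (Fin Z → ℝ)} [IsProbabilityMeasure F]
    {μ : Fin Z → ℝ} {S : Matrix (Fin Z) (Fin Z) ℝ}
    (h1 : ∀ z : Fin Z, ∫ ξ, ξ z ∂F = μ z)
    (h2 : ∀ z z' : Fin Z, ∫ ξ, ξ z * ξ z' ∂F = S z z' + μ z * μ z')
    (i j : Fin (Z + 1)) :
    ∫ ξ, homogenize ξ i * homogenize ξ j ∂F = momentMatrix μ S i j := by
  refine Fin.lastCases ?_ (fun i => ?_) i <;> refine Fin.lastCases ?_ (fun j => ?_) j <;>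
    simp [h1, h2, momentMatrix]

lemma homogenize_quadForm_eq_sum {Z : ℕ} (H : Matrix (Fin (Z + 1)) (Fin (Z + 1)) ℝ)
    (ξ : Fin Z → ℝ) :
    homogenize ξ ⬝ᵥ H *ᵥ homogenize ξ =
      ∑ i, ∑ j, homogenize ξ i * homogenize ξ j * H i j := by
  simp only [dotProduct, mulVec, Finset.mul_sum]
  exact Finset.sum_congr rfl fun i _ => Finset.sum_congr rfl fun j _ => by ring

theorem stmt11 (Z M : ℕ) (hM : 1 ≤ M) (ε : ℝ) (hε : ε ∈ Set.Ioo (0 : ℝ) 1)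
    (l u : Fin Z → ℝ) (hlu : ∀ z, l z ≤ u z)
    (μ : Fin Z → ℝ) (S : Matrix (Fin Z) (Fin Z) ℝ) (hS : S.IsSymm)
    (y : Fin M → Fin Z → ℝ) (y0 : Fin M → ℝ) (γ : Fin M → ℝ) (hγ : ∀ m, 0 < γ m)
    (hfeas : ∃ (H : Matrix (Fin (Z + 1)) (Fin (Z + 1)) ℝ) (β : ℝ)
        (τ0 : Fin Z → ℝ) (τ : Fin M → Fin Z → ℝ),
      H.IsSymm ∧ (∀ z, 0 ≤ τ0 z) ∧ (∀ m z, 0 ≤ τ m z) ∧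
        β + ε⁻¹ * (momentMatrix μ S * H).trace ≤ 0 ∧
        (H + ∑ z : Fin Z, τ0 z • suppW l u z).PosSemidef ∧
        ∀ m : Fin M, (H + ∑ z : Fin Z, τ m z • suppW l u z -
          borderMat ((γ m / 2) • y m) (γ m * y0 m - β)).PosSemidef) :
    ∀ (F : Measure (Fin Z → ℝ)), IsProbabilityMeasure F →
      F {ξ : Fin Z → ℝ | ∀ z, l z ≤ ξ z ∧ ξ z ≤ u z} = 1 →
      (∀ z : Fin Z, Integrable (fun ξ : Fin Z → ℝ => ξ z) F) →
      (∀ z z' : Fin Z, Integrable (fun ξ : Fin Z → ℝ => ξ z * ξ z') F) →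
      (∀ z : Fin Z, ∫ ξ, ξ z ∂F = μ z) →
      (∀ z z' : Fin Z, ∫ ξ, ξ z * ξ z' ∂F = S z z' + μ z * μ z') →
      F {ξ : Fin Z → ℝ | ∀ m, y m ⬝ᵥ ξ + y0 m ≤ 0} ≥ ENNReal.ofReal (1 - ε) := by
  rintro F hF hsupp hint1 hint2 hmean hmom
  obtain ⟨H, β, τ0, τ, hH, hτ0, hτ, htr, hpsd0, hpsd⟩ := hfeas
  obtain ⟨hε0, -⟩ := hε
  set q : (Fin Z → ℝ) → ℝ := fun ξ => homogenize ξ ⬝ᵥ H *ᵥ homogenize ξ with hq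
  have hI := integrable_homogenize_mul hint1 hint2
  have hq_eq : q = fun ξ => ∑ i, ∑ j, homogenize ξ i * homogenize ξ j * H i j :=
    funext (homogenize_quadForm_eq_sum H)
  have hterm (i j : Fin (Z + 1)) :
      Integrable (fun ξ => homogenize ξ i * homogenize ξ j * H i j) F := (hI i j).mul_const _
  have hq_int : Integrable q F := by
    rw [hq_eq]
    exact integrable_finsetSum _ fun i _ => integrable_finsetSum _ fun j _ => hterm i j
  have hq_integral : ∫ ξ, q ξ ∂F = (momentMatrix μ S * H).trace := by
    simp only [hq_eq]
    rw [integral_finsetSum _ fun i _ => integrable_finsetSum _ fun j _ => hterm i j]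
    simp only [trace, diag_apply, mul_apply]
    refine Finset.sum_congr rfl fun i _ => ?_
    rw [integral_finsetSum _ fun j _ => hterm i j]
    refine Finset.sum_congr rfl fun j _ => ?_
    rw [integral_mul_const, integral_homogenize_mul hmean hmom, hH.apply]
  have hq_nonneg (ξ : Fin Z → ℝ) (hξ : ∀ z, l z ≤ ξ z ∧ ξ z ≤ u z) : 0 ≤ q ξ := by
    have h := hpsd0.dotProduct_mulVec_nonneg (homogenize ξ)
    rw [star_trivial, add_mulVec, dotProduct_add] at h
    linarith [homogenize_dotProduct_sum_suppW_mulVec_nonpos hτ0 hξ]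
  have hq_lower (ξ : Fin Z → ℝ) (hξ : ∀ z, l z ≤ ξ z ∧ ξ z ≤ u z) (m : Fin M) :
      γ m * (y m ⬝ᵥ ξ + y0 m) - β ≤ q ξ := by
    have h := (hpsd m).dotProduct_mulVec_nonneg (homogenize ξ)
    rw [star_trivial, sub_mulVec, dotProduct_sub, add_mulVec, dotProduct_add,
      homogenize_dotProduct_borderMat_mulVec, smul_dotProduct, smul_eq_mul] at h
    linarith [homogenize_dotProduct_sum_suppW_mulVec_nonpos (hτ m) hξ]
  have hΞ_meas : MeasurableSet {ξ : Fin Z → ℝ | ∀ z, l z ≤ ξ z ∧ ξ z ≤ u z} := by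
    measurability
  have hΞ : ∀ᵐ ξ ∂F, ∀ z, l z ≤ ξ z ∧ ξ z ≤ u z := (mem_ae_iff_prob_eq_one hΞ_meas).2 hsupp
  have hq_ae : 0 ≤ᵐ[F] q := hΞ.mono hq_nonneg
  set G : Set (Fin Z → ℝ) := {ξ | ∀ m, y m ⬝ᵥ ξ + y0 m ≤ 0} with hG
  have hG_meas : MeasurableSet G := by
    simp only [hG, dotProduct]
    measurability
  have hbad : ∀ᵐ ξ ∂F, ξ ∉ G → -β < q ξ := by
    filter_upwards [hΞ] with ξ hξ hξG
    simp only [hG, Set.mem_ofPred_eq, not_forall, not_le] at hξG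
    obtain ⟨m, hm⟩ := hξG
    linarith [hq_lower ξ hξ m, mul_pos (hγ m) hm]
  have hT : 0 ≤ ∫ ξ, q ξ ∂F := integral_nonneg_of_ae hq_ae
  rw [← hq_integral] at htr
  have hTβ : ∫ ξ, q ξ ∂F ≤ ε * -β := by
    have := mul_le_mul_of_nonneg_left htr hε0.le
    rw [mul_add, mul_inv_cancel_left₀ hε0.ne'] at this
    linarith
  have hFG : F.real Gᶜ ≤ ε := by
    rcases (nonneg_of_mul_nonneg_right (hT.trans hTβ) hε0).eq_or_lt with hβ | hβ
    · have hq0 : q =ᵐ[F] 0 := (integral_eq_zero_iff_of_nonneg_ae hq_ae hq_int).1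
        (le_antisymm (by simpa [← hβ] using hTβ) hT)
      have hzero : F Gᶜ = 0 := by
        rw [← mem_ae_iff]
        filter_upwards [hbad, hq0] with ξ h1 h2
        by_contra h
        have := h1 h
        simp [h2, ← hβ] at this
      simp [Measure.real, hzero, hε0.le]
    · have hle : F.real Gᶜ ≤ F.real {ξ | -β ≤ q ξ} :=
        ENNReal.toReal_mono (measure_ne_top F _)
          (measure_mono_ae (hbad.mono fun ξ h hξ => (h hξ).le))
      have hmarkov := mul_meas_ge_le_integral_of_nonneg hq_ae hq_int (-β)
      nlinarith
  rw [ge_iff_le, ENNReal.ofReal_le_iff_le_toReal (measure_ne_top F G)]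
  have := probReal_compl_eq_one_sub (μ := F) hG_meas
  change 1 - ε ≤ F.real G
  linarith
end
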